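/- Let S be a ℂ-linear subspace of the m×n complex matrices, let E ∈ S attain the maximal rank of S, and let E' ∈ S satisfy Im(E') ⊄ Im(E) and Ker(E) ⊄ Ker(E'). Then there exists r ∈ ℂ such that rank(E ⊗ E + r·(E' ⊗ E')) > rank(E)², where ⊗ denotes the Kronecker product. In particular mrk(S ⊗ S) > mrk(S)². -/

import Mathlib

open Matrix

noncomputable def mrk {m n : Type*} [Fintype m] [Fintype n]
    (S : Submodule ℂ (Matrix m n ℂ)) : ℕ :=
  sSup (Matrix.rank '' (S : Set (Matrix m n ℂ)))

noncomputable def tensorSpace {m₁ n₁ m₂ n₂ : Type*}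
    (S : Submodule ℂ (Matrix m₁ n₁ ℂ)) (T : Submodule ℂ (Matrix m₂ n₂ ℂ)) :
    Submodule ℂ (Matrix (m₁ × m₂) (n₁ × n₂) ℂ) :=
  Submodule.span ℂ {M | ∃ A ∈ S, ∃ B ∈ T, M = Matrix.kroneckerMap (· * ·) A B}

noncomputable def tensorPow {d : ℕ} (S : Submodule ℂ (Matrix (Fin d) (Fin d) ℂ)) (n : ℕ) :
    Submodule ℂ (Matrix (Fin n → Fin d) (Fin n → Fin d) ℂ) :=
  Submodule.span ℂ {M | ∃ A : Fin n → Matrix (Fin d) (Fin d) ℂ,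
    (∀ k, A k ∈ S) ∧ M = fun i j => ∏ k, A k (i k) (j k)}

noncomputable def spaceImageOf {ι κ : Type*} [Fintype κ]
    (S : Submodule ℂ (Matrix ι κ ℂ)) (U : Submodule ℂ (κ → ℂ)) : Submodule ℂ (ι → ℂ) :=
  Submodule.span ℂ {v | ∃ A ∈ S, ∃ u ∈ U, v = A.mulVec u}

def HasShrunkSubspace {ι : Type*} [Fintype ι]
    (S : Submodule ℂ (Matrix ι ι ℂ)) : Prop :=
  ∃ U : Submodule ℂ (ι → ℂ),
    Module.finrank ℂ (spaceImageOf S U) < Module.finrank ℂ U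

noncomputable def compSpace (p q m n : ℕ) : Submodule ℂ (Matrix (Fin m) (Fin n) ℂ) where
  carrier := {A | ∀ (i : Fin m) (j : Fin n), p ≤ (i : ℕ) → q ≤ (j : ℕ) → A i j = 0}
  add_mem' := by
    intro a b ha hb i j hi hj
    simp only [Matrix.add_apply, ha i j hi hj, hb i j hi hj, add_zero]
  zero_mem' := by intro i j _ _; rfl
  smul_mem' := by
    intro c a ha i j hi hj
    simp only [Matrix.smul_apply, ha i j hi hj, smul_zero]

/-- A perturbation of `P` along `Q` raises the rank as soon as `Q` does not map the kernel of `P`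
into the column space of `P`. -/
theorem Matrix.exists_rank_lt_rank_add_smul {m n : Type*} [Fintype m] [Fintype n]
    (P Q : Matrix m n ℂ) (v : n → ℂ) (hv : P *ᵥ v = 0)
    (hQ : Q *ᵥ v ∉ LinearMap.range P.mulVecLin) :
    ∃ r : ℂ, P.rank < (P + r • Q).rank := by
  let b := Module.finBasis ℂ (LinearMap.range P.mulVecLin)
  choose u hu using fun i => (b i).2
  have hspan : Submodule.span ℂ (Set.range fun i => P *ᵥ u i) ≤ LinearMap.range P.mulVecLin :=
    Submodule.span_le.2 (by rintro _ ⟨i, rfl⟩; exact ⟨u i, rfl⟩)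
  have hli : LinearIndependent ℂ fun i => P *ᵥ u i := by
    have hb : (fun i => P *ᵥ u i) = (LinearMap.range P.mulVecLin).subtype ∘ b := funext hu
    rw [hb]
    exact b.linearIndependent.map' _ (Submodule.ker_subtype _)
  let g : ℂ → Option (Fin (Module.finrank ℂ (LinearMap.range P.mulVecLin))) → m → ℂ :=
    fun r o => o.elim (Q *ᵥ v) fun i => P *ᵥ u i + r • Q *ᵥ u i
  have hg : Continuous g := by
    refine continuous_pi fun o => ?_
    cases o <;> simp only [g, Option.elim] <;> fun_prop
  have hg0 : LinearIndependent ℂ (g 0) := by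
    rw [linearIndependent_option]
    simp only [g, Function.comp_def, Option.elim, zero_smul, add_zero]
    exact ⟨hli, fun h => hQ (hspan h)⟩
  have hopen : IsOpen (g ⁻¹' {f | LinearIndependent ℂ f}) :=
    isOpen_setOfPred_linearIndependent.preimage hg
  have hev : ∀ᶠ r in nhdsWithin (0 : ℂ) {0}ᶜ, LinearIndependent ℂ (g r) :=
    nhdsWithin_le_nhds (hopen.mem_nhds hg0)
  obtain ⟨r, hr, hr0⟩ := (hev.and self_mem_nhdsWithin).exists
  have hr0 : r ≠ 0 := hr0
  refine ⟨r, ?_⟩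
  have hle : Submodule.span ℂ (Set.range (g r)) ≤ LinearMap.range (P + r • Q).mulVecLin := by
    refine Submodule.span_le.2 ?_
    rintro _ ⟨o, rfl⟩
    cases o with
    | none =>
      refine ⟨r⁻¹ • v, ?_⟩
      simp [g, hv, hr0]
    | some i => exact ⟨u i, by simp [g]⟩
  have h := Submodule.finrank_mono hle
  rw [finrank_span_eq_card hr, Fintype.card_option, Fintype.card_fin] at h
  exact h

theorem Matrix.exists_mul_mul_eq_one {K m n : Type*} [Field K] [Fintype m] [Fintype n]
    [DecidableEq m] [DecidableEq n] (A : Matrix m n K) :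
    ∃ (L : Matrix (Fin A.rank) m K) (R : Matrix n (Fin A.rank) K), L * A * R = 1 := by
  let e : LinearMap.range A.mulVecLin ≃ₗ[K] (Fin A.rank → K) :=
    (Module.finBasis K (LinearMap.range A.mulVecLin)).equivFun
  obtain ⟨s, hs⟩ := A.mulVecLin.rangeRestrict.exists_rightInverse_of_surjective
    (LinearMap.range_rangeRestrict _)
  obtain ⟨p, hp⟩ := (LinearMap.range A.mulVecLin).subtype.exists_leftInverse_of_injective
    (Submodule.ker_subtype _)
  refine ⟨LinearMap.toMatrix' (e.toLinearMap ∘ₗ p),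
    LinearMap.toMatrix' (s ∘ₗ e.symm.toLinearMap), ?_⟩
  apply Matrix.toLin'.injective
  refine LinearMap.ext fun x => ?_
  simp only [Matrix.toLin'_mul, Matrix.toLin'_toMatrix', LinearMap.comp_apply, Matrix.toLin'_one,
    LinearMap.id_apply, LinearEquiv.coe_coe]
  have h1 : toLin' A (s (e.symm x)) = (LinearMap.range A.mulVecLin).subtype (e.symm x) :=
    congrArg Subtype.val (LinearMap.congr_fun hs (e.symm x))
  rw [h1, ← LinearMap.comp_apply p, hp]
  simp

theorem Matrix.rank_mul_rank_le_rank_kronecker {K m n p q : Type*} [Field K] [Fintype m]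
    [Fintype n] [Fintype p] [Fintype q] (A : Matrix m n K) (B : Matrix p q K) :
    A.rank * B.rank ≤ (kroneckerMap (· * ·) A B).rank := by
  classical
  obtain ⟨L, R, h⟩ := A.exists_mul_mul_eq_one
  obtain ⟨L', R', h'⟩ := B.exists_mul_mul_eq_one
  have hmul : kroneckerMap (· * ·) L L' * kroneckerMap (· * ·) A B * kroneckerMap (· * ·) R R'
      = 1 := by
    rw [← mul_kronecker_mul, ← mul_kronecker_mul, h, h', one_kronecker_one]
  calc
    A.rank * B.rank =
        (1 : Matrix (Fin A.rank × Fin B.rank) (Fin A.rank × Fin B.rank) K).rank := by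
      rw [rank_one, Fintype.card_prod, Fintype.card_fin, Fintype.card_fin]
    _ ≤ _ := by
      rw [← hmul]
      exact (rank_mul_le_left _ _).trans (rank_mul_le_right _ _)

theorem Matrix.kronecker_mulVec_mul {R m n p q : Type*} [CommSemiring R] [Fintype n] [Fintype q]
    (A : Matrix m n R) (B : Matrix p q R) (x : n → R) (y : q → R) :
    (kroneckerMap (· * ·) A B *ᵥ fun c => x c.1 * y c.2) =
      fun c => (A *ᵥ x) c.1 * (B *ᵥ y) c.2 := by
  funext c
  simp only [mulVec, dotProduct, kroneckerMap_apply, Fintype.sum_prod_type, Finset.sum_mul_sum]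
  exact Finset.sum_congr rfl fun a _ => Finset.sum_congr rfl fun b _ => by ring

theorem Matrix.mem_range_of_mul_mem_range_kronecker {K m n p q : Type*} [Field K] [Fintype n]
    [Fintype q] (A : Matrix m n K) (B : Matrix p q K) {a : m → K} {b : p → K} (ha : a ≠ 0)
    (h : (fun c : m × p => a c.1 * b c.2) ∈
      LinearMap.range (kroneckerMap (· * ·) A B).mulVecLin) :
    b ∈ LinearMap.range B.mulVecLin := by
  obtain ⟨z, hz⟩ := h
  obtain ⟨i, hi⟩ := Function.ne_iff.1 ha
  have hi : a i ≠ 0 := hi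
  refine ((LinearMap.range B.mulVecLin).smul_mem_iff hi).1
    ⟨fun d => ∑ c, A i c * z (c, d), ?_⟩
  funext j
  have hj := congrFun hz (i, j)
  simp only [mulVecLin_apply, mulVec, dotProduct, kroneckerMap_apply,
    Fintype.sum_prod_type] at hj ⊢
  rw [Pi.smul_apply, smul_eq_mul, ← hj, Finset.sum_comm]
  refine Finset.sum_congr rfl fun d _ => ?_
  rw [Finset.mul_sum]
  exact Finset.sum_congr rfl fun c _ => by ring

theorem rank_le_mrk {m n : Type*} [Fintype m] [Fintype n] {S : Submodule ℂ (Matrix m n ℂ)}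
    {A : Matrix m n ℂ} (hA : A ∈ S) : A.rank ≤ mrk S :=
  le_csSup ⟨Fintype.card n, by rintro _ ⟨B, _, rfl⟩; exact B.rank_le_card_width⟩ ⟨A, hA, rfl⟩

theorem stmt7 {m n : ℕ} (S : Submodule ℂ (Matrix (Fin m) (Fin n) ℂ))
    (E E' : Matrix (Fin m) (Fin n) ℂ) (hE : E ∈ S) (hrank : E.rank = mrk S)
    (hE' : E' ∈ S)
    (him : ¬ LinearMap.range (Matrix.mulVecLin E') ≤ LinearMap.range (Matrix.mulVecLin E))
    (hker : ¬ LinearMap.ker (Matrix.mulVecLin E) ≤ LinearMap.ker (Matrix.mulVecLin E')) :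
    (∃ r : ℂ, (E.rank) ^ 2 <
      (Matrix.kroneckerMap (· * ·) E E + r • Matrix.kroneckerMap (· * ·) E' E').rank) ∧
    (mrk S) ^ 2 < mrk (tensorSpace S S) := by
  have hex : ∃ r : ℂ, (E.rank) ^ 2 <
      (Matrix.kroneckerMap (· * ·) E E + r • Matrix.kroneckerMap (· * ·) E' E').rank := by
    obtain ⟨_, ⟨y, rfl⟩, hy⟩ := SetLike.not_le_iff_exists.1 him
    obtain ⟨x, hx, hx'⟩ := SetLike.not_le_iff_exists.1 hker
    rw [LinearMap.mem_ker, mulVecLin_apply] at hx hx'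
    obtain ⟨r, hr⟩ := exists_rank_lt_rank_add_smul (kroneckerMap (· * ·) E E)
      (kroneckerMap (· * ·) E' E') (fun c => x c.1 * y c.2)
      (by rw [kronecker_mulVec_mul, hx]; funext c; simp)
      (by
        rw [kronecker_mulVec_mul]
        exact fun h => hy (mem_range_of_mul_mem_range_kronecker E E hx' h))
    exact ⟨r, lt_of_le_of_lt ((sq _).trans_le (rank_mul_rank_le_rank_kronecker E E)) hr⟩
  refine ⟨hex, ?_⟩
  obtain ⟨r, hr⟩ := hex
  rw [← hrank]
  refine hr.trans_le (rank_le_mrk (Submodule.add_mem _ ?_ (Submodule.smul_mem _ r ?_)))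
  · exact Submodule.subset_span ⟨E, hE, E, hE, rfl⟩
  · exact Submodule.subset_span ⟨E', hE', E', hE', rfl⟩
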